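/- Let r > 0, s ∈ (r, r+1), a > 0, λ > 0, and let X follow the Gamma distribution Γ(a,λ) with density f(x) = (λ^a/Γ(a)) x^{a−1} e^{−λx} 1_{{x>0}} on ℝ. Let (α_n)_{n≥1} be an L^r(P)-optimal sequence of quantizers for X. Then: (i) the sequence (θ·α_n)_{n≥1} is L^s(P)-rate-optimal if and only if θ ∈ (s/(r+1), ∞); (ii) the function θ ↦ θ^{s+1} ∫_0^∞ f(θx) f(x)^{−s/(r+1)} dx attains a unique minimum on (s/(r+1), ∞) at θ* = (s+a)/(r+a). -/

import Mathlib

open MeasureTheory ENNReal Filter Set Metric Topology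
open scoped Classical

noncomputable section

/-- Distance from a point `x ∈ ℝ` to a finite codebook `α`. -/
def qdist1 (x : ℝ) (α : Finset ℝ) : ℝ := Metric.infDist x (α : Set ℝ)

/-- The `r`-th power `L^r` quantization error `∫ d(x,α)^r dP` of a codebook `α`. -/
def qerr1 (P : Measure ℝ) (r : ℝ) (α : Finset ℝ) : ℝ≥0∞ :=
  ∫⁻ x, ENNReal.ofReal (qdist1 x α) ^ r ∂P

/-- The optimal `n`-level `L^r` quantization error `e_{n,r}(P)`. -/
def enr1 (P : Measure ℝ) (r : ℝ) (n : ℕ) : ℝ≥0∞ :=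
  ⨅ (α : Finset ℝ) (_ : α.Nonempty) (_ : α.card ≤ n), qerr1 P r α ^ (1 / r)

/-- The constant `J_{r,1} = inf_{n ≥ 1} n^r e_{n,r}(U([0,1]))^r`. -/
def J1 (r : ℝ) : ℝ≥0∞ :=
  ⨅ (n : ℕ) (_ : 1 ≤ n), (n : ℝ≥0∞) ^ r * enr1 (volume.restrict (Icc (0 : ℝ) 1)) r n ^ r

/-- Zador's constant `Q_r(P)` on `ℝ` for `P = f·λ_1`. -/
def Q1 (f : ℝ → ℝ) (r : ℝ) : ℝ≥0∞ :=
  J1 r * (∫⁻ x, ENNReal.ofReal (f x) ^ (1 / (1 + r))) ^ (1 + r : ℝ)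

/-- The scaled codebook `θ·α = {θa : a ∈ α}`. -/
def scaleCB (θ : ℝ) (α : Finset ℝ) : Finset ℝ := α.image fun a => θ * a

/-- An `L^r(P)`-optimal sequence of `n`-quantizers on `ℝ`. -/
def OptimalSeq1 (P : Measure ℝ) (r : ℝ) (α : ℕ → Finset ℝ) : Prop :=
  ∀ n, 1 ≤ n → (α n).Nonempty ∧ (α n).card ≤ n ∧ qerr1 P r (α n) = enr1 P r n ^ r

/-- An asymptotically `L^r(P)`-optimal sequence of quantizers on `ℝ`, `P = f·λ_1`. -/
def AsympOptimalSeq1 (P : Measure ℝ) (f : ℝ → ℝ) (r : ℝ) (α : ℕ → Finset ℝ) : Prop :=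
  (∀ n, 1 ≤ n → (α n).Nonempty ∧ (α n).card ≤ n) ∧
  Tendsto (fun n : ℕ => (n : ℝ≥0∞) ^ r * qerr1 P r (α n)) atTop (𝓝 (Q1 f r))

/-- `L^s(P)`-rate-optimality of a sequence of codebooks on `ℝ`. -/
def RateOptimal1 (P : Measure ℝ) (s : ℝ) (β : ℕ → Finset ℝ) : Prop :=
  limsup (fun n : ℕ => (n : ℝ≥0∞) ^ s * qerr1 P s (β n)) atTop < ⊤

/-- The density of the Gamma distribution `Γ(a,λ)`. -/
def gammaDensity (a l x : ℝ) : ℝ :=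
  if 0 < x then l ^ a / Real.Gamma a * x ^ (a - 1) * Real.exp (-(l * x)) else 0

/-- `θ ↦ θ^{s+1} ∫_0^∞ f(θx) f(x)^{-s/(r+1)} dx` for the `Γ(a,λ)` density `f`. -/
def gammaF (a l r s θ : ℝ) : ℝ≥0∞ :=
  ENNReal.ofReal θ ^ (s + 1 : ℝ) *
    ∫⁻ x in Ioi (0 : ℝ), ENNReal.ofReal (gammaDensity a l (θ * x)) *
      ENNReal.ofReal (gammaDensity a l x) ^ (-(s / (r + 1)))

lemma qdist1_nonneg (x : ℝ) (α : Finset ℝ) : 0 ≤ qdist1 x α := infDist_nonneg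

lemma qerr1_exchange {P : Measure ℝ} {r : ℝ} (hr : 0 < r) {α : Finset ℝ}
    (hfin : qerr1 P r α ≠ ⊤)
    (hopt : ∀ β : Finset ℝ, β.Nonempty → β.card ≤ α.card → qerr1 P r α ≤ qerr1 P r β)
    {p q t : ℝ} (hp : p ∈ α) (hq : q ∈ α) (ht : t ∈ α) (hpq : p < q) (hqt : q < t) (y : ℝ) :
    ENNReal.ofReal (((3 / 4) ^ r - (1 / 4) ^ r) * infDist y (α : Set ℝ) ^ r) *
        P (closedBall y (infDist y (α : Set ℝ) / 4)) ≤
      ENNReal.ofReal ((t - p) ^ r) * P (Icc p t) := by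
  set D := infDist y (α : Set ℝ) with hD
  have hD0 : 0 ≤ D := infDist_nonneg
  set β : Finset ℝ := insert y (α.erase q) with hβ
  have hβne : β.Nonempty := ⟨y, by simp [hβ]⟩
  have hβcard : β.card ≤ α.card := by
    refine (Finset.card_insert_le _ _).trans ?_
    rw [Finset.card_erase_of_mem hq]
    have := Finset.card_pos.2 ⟨q, hq⟩
    omega
  have hpβ : p ∈ (β : Set ℝ) := by simp [hβ, hp, hpq.ne]
  have htβ : t ∈ (β : Set ℝ) := by simp [hβ, ht, hqt.ne']
  have hyβ : y ∈ (β : Set ℝ) := by simp [hβ]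
  have hκ : 0 ≤ ((3 / 4 : ℝ) ^ r - (1 / 4) ^ r) :=
    sub_nonneg.2 (Real.rpow_le_rpow (by norm_num) (by norm_num) hr.le)
  have hpt : ∀ x, ENNReal.ofReal (qdist1 x β) ^ r +
      (closedBall y (D / 4)).indicator
        (fun _ => ENNReal.ofReal (((3 / 4) ^ r - (1 / 4) ^ r) * D ^ r)) x ≤
      ENNReal.ofReal (qdist1 x α) ^ r +
        (Icc p t).indicator (fun _ => ENNReal.ofReal ((t - p) ^ r)) x := by
    intro x
    by_cases hxB : x ∈ closedBall y (D / 4)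
    · have hxy : dist x y ≤ D / 4 := hxB
      have h1 : qdist1 x β ≤ D / 4 := (infDist_le_dist_of_mem hyβ).trans hxy
      have h2 : 3 / 4 * D ≤ qdist1 x α := by
        have : infDist y (α : Set ℝ) ≤ infDist x (α : Set ℝ) + dist y x :=
          infDist_le_infDist_add_dist
        rw [dist_comm] at this
        unfold qdist1
        linarith
      rw [indicator_of_mem hxB]
      refine le_trans ?_ le_self_add
      have h3 : ENNReal.ofReal (qdist1 x β) ^ r ≤ ENNReal.ofReal ((1 / 4) ^ r * D ^ r) := by
        rw [ENNReal.ofReal_rpow_of_nonneg (qdist1_nonneg _ _) hr.le]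
        rw [← Real.mul_rpow (by norm_num) hD0]
        exact ENNReal.ofReal_le_ofReal
          (Real.rpow_le_rpow infDist_nonneg (by linarith) hr.le)
      have h4 : ENNReal.ofReal ((3 / 4) ^ r * D ^ r) ≤ ENNReal.ofReal (qdist1 x α) ^ r := by
        rw [ENNReal.ofReal_rpow_of_nonneg (qdist1_nonneg _ _) hr.le]
        rw [← Real.mul_rpow (by norm_num) hD0]
        exact ENNReal.ofReal_le_ofReal
          (Real.rpow_le_rpow (by positivity) h2 hr.le)
      refine le_trans (add_le_add_left h3 _) (le_trans ?_ h4)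
      rw [← ENNReal.ofReal_add (by positivity) (by positivity)]
      apply ENNReal.ofReal_le_ofReal
      apply le_of_eq
      ring
    · rw [indicator_of_notMem hxB, add_zero]
      by_cases hxI : x ∈ Icc p t
      · rw [indicator_of_mem hxI]
        refine le_trans ?_ le_add_self
        rw [ENNReal.ofReal_rpow_of_nonneg (qdist1_nonneg _ _) hr.le]
        refine ENNReal.ofReal_le_ofReal (Real.rpow_le_rpow infDist_nonneg ?_ hr.le)
        refine (infDist_le_dist_of_mem hpβ).trans ?_
        rw [Real.dist_eq, abs_of_nonneg (by linarith [hxI.1])]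
        linarith [hxI.2]
      · rw [indicator_of_notMem hxI, add_zero]
        refine ENNReal.rpow_le_rpow (ENNReal.ofReal_le_ofReal ?_) hr.le
        refine (le_infDist ⟨p, hp⟩).2 fun {z} hz => ?_
        by_cases hzq : z = q
        · subst hzq
          rcases lt_or_ge x p with hx | hx
          · refine (infDist_le_dist_of_mem hpβ).trans ?_
            rw [Real.dist_eq, Real.dist_eq, abs_of_neg (by linarith), abs_of_neg (by linarith)]
            linarith
          · have hx' : t < x := by
              by_contra h
              exact hxI ⟨hx, not_lt.1 h⟩
            refine (infDist_le_dist_of_mem htβ).trans ?_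
            rw [Real.dist_eq, Real.dist_eq, abs_of_pos (by linarith), abs_of_pos (by linarith)]
            linarith
        · refine infDist_le_dist_of_mem ?_
          have : z ∈ α := hz
          simp [hβ, this, hzq]
  have hint := lintegral_mono (μ := P) hpt
  have hmeas : ∀ γ : Finset ℝ, Measurable fun x => ENNReal.ofReal (qdist1 x γ) ^ r := fun γ =>
    ((measurable_infDist).ennreal_ofReal).pow_const r
  rw [lintegral_add_left (hmeas β), lintegral_add_left (hmeas α),
    lintegral_indicator_const isClosed_closedBall.measurableSet,
    lintegral_indicator_const measurableSet_Icc] at hint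
  exact (ENNReal.add_le_add_iff_left hfin).1
    ((add_le_add_left (hopt β hβne hβcard) _).trans hint)

lemma exists_close_triple {α : Finset ℝ} {u v : ℝ} (huv : u < v) {M : ℕ} (hM : 1 ≤ M)
    (h : 2 * M < (α.filter fun x => x ∈ Ico u v).card) :
    ∃ p ∈ α, ∃ q ∈ α, ∃ t ∈ α, p < q ∧ q < t ∧ u ≤ p ∧ t < v ∧ t - p ≤ (v - u) / M := by
  have hM0 : (0 : ℝ) < M := by exact_mod_cast hM
  have hvu : 0 < v - u := sub_pos.2 huv
  obtain ⟨j, hj, hcard⟩ := Finset.exists_lt_card_fiber_of_mul_lt_card_of_maps_to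
    (s := α.filter fun x => x ∈ Ico u v) (t := Finset.range M) (n := 2)
    (f := fun x => ⌊(x - u) * M / (v - u)⌋₊) (by
      intro x hx
      simp only [Finset.mem_filter, mem_Ico] at hx
      simp only [Finset.mem_range]
      rw [Nat.floor_lt (by have := hx.2.1; have := sub_nonneg.2 this; positivity)]
      rw [div_lt_iff₀ hvu, mul_comm]
      exact mul_lt_mul_of_pos_left (by linarith [hx.2.2]) hM0)
    (by simpa [mul_comm] using h)
  obtain ⟨e, he⟩ : ∃ e : Fin 3 → ℝ, StrictMono e ∧ ∀ i, e i ∈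
      (α.filter fun x => x ∈ Ico u v).filter fun x => ⌊(x - u) * M / (v - u)⌋₊ = j := by
    obtain ⟨s', hs', hc⟩ := Finset.exists_subset_card_eq (n := 3) hcard
    exact ⟨s'.orderEmbOfFin hc, (s'.orderEmbOfFin hc).strictMono,
      fun i => hs' (s'.orderEmbOfFin_mem hc i)⟩
  have hmem : ∀ i, e i ∈ α ∧ (u ≤ e i ∧ e i < v) ∧ ⌊(e i - u) * M / (v - u)⌋₊ = j := by
    intro i
    have := he.2 i
    simpa [and_assoc] using this
  refine ⟨e 0, (hmem 0).1, e 1, (hmem 1).1, e 2, (hmem 2).1, he.1 (by decide), he.1 (by decide),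
    (hmem 0).2.1.1, (hmem 2).2.1.2, ?_⟩
  have h0 : (j : ℝ) ≤ (e 0 - u) * M / (v - u) := by
    rw [← (hmem 0).2.2]
    have := sub_nonneg.2 (hmem 0).2.1.1
    exact Nat.floor_le (by positivity)
  have h2 : (e 2 - u) * M / (v - u) < j + 1 := by
    conv_rhs => rw [← (hmem 2).2.2]
    exact Nat.lt_floor_add_one _
  rw [le_div_iff₀ hM0]
  rw [le_div_iff₀ hvu] at h0
  rw [div_lt_iff₀ hvu] at h2
  nlinarith

lemma volume_far_ge {α : Finset ℝ} (hα : α.Nonempty) {u v ε : ℝ} (hε : 0 < ε)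
    (hN : 2 * ε * (α.filter fun x => x ∈ Ico (u - 2 * ε) (v + 2 * ε)).card ≤ (v - u) / 2) :
    ENNReal.ofReal ((v - u) / 2) ≤ volume (Icc u v ∩ {x | ε ≤ infDist x (α : Set ℝ)}) := by
  set N := (α.filter fun x => x ∈ Ico (u - 2 * ε) (v + 2 * ε)) with hNdef
  have hsub : Icc u v ⊆ (Icc u v ∩ {x | ε ≤ infDist x (α : Set ℝ)}) ∪
      ⋃ z ∈ N, ball z ε := by
    intro x hx
    by_cases hxe : ε ≤ infDist x (α : Set ℝ)
    · exact Or.inl ⟨hx, hxe⟩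
    · right
      obtain ⟨z, hz, hxz⟩ := (infDist_lt_iff (s := (α : Set ℝ)) hα).1 (not_le.1 hxe)
      simp only [mem_iUnion]
      refine ⟨z, ?_, hxz⟩
      have h1 := abs_lt.1 ((Real.dist_eq x z) ▸ hxz)
      simp only [hNdef, Finset.mem_filter, mem_Ico]
      exact ⟨hz, by linarith [hx.1], by linarith [hx.2]⟩
  have h1 : ENNReal.ofReal (v - u) ≤ volume (Icc u v ∩ {x | ε ≤ infDist x (α : Set ℝ)}) +
      ENNReal.ofReal ((v - u) / 2) := by
    rw [← Real.volume_Icc]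
    refine (measure_mono hsub).trans ((measure_union_le _ _).trans (add_le_add_right ?_ _))
    refine (measure_biUnion_finset_le _ _).trans ?_
    simp only [Real.volume_ball, Finset.sum_const, nsmul_eq_mul]
    rw [← ENNReal.ofReal_natCast, ← ENNReal.ofReal_mul (by positivity)]
    exact ENNReal.ofReal_le_ofReal (by linarith)
  have h2 : 0 ≤ (v - u) / 2 := le_trans (by positivity) hN
  have h3 : ENNReal.ofReal (v - u) = ENNReal.ofReal ((v - u) / 2) + ENNReal.ofReal ((v - u) / 2) := by
    rw [← ENNReal.ofReal_add h2 h2]; congr 1; ring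
  rw [h3] at h1
  exact (ENNReal.add_le_add_iff_right ENNReal.ofReal_ne_top).1 h1

lemma withDensity_ge {f : ℝ → ℝ} {m : ℝ} {S : Set ℝ} (hS : MeasurableSet S)
    (hf : ∀ x ∈ S, m ≤ f x) :
    ENNReal.ofReal m * volume S ≤ (volume.withDensity fun x => ENNReal.ofReal (f x)) S := by
  rw [withDensity_apply _ hS, ← setLIntegral_const]
  exact setLIntegral_mono' hS fun x hx => ENNReal.ofReal_le_ofReal (hf x hx)

lemma withDensity_le {f : ℝ → ℝ} {m : ℝ} {S : Set ℝ} (hS : MeasurableSet S)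
    (hf : ∀ x ∈ S, f x ≤ m) :
    (volume.withDensity fun x => ENNReal.ofReal (f x)) S ≤ ENNReal.ofReal m * volume S := by
  rw [withDensity_apply _ hS, ← setLIntegral_const]
  exact setLIntegral_mono' hS fun x hx => ENNReal.ofReal_le_ofReal (hf x hx)

/-- A codebook that is `L^r`-optimal among all codebooks of at most its own cardinality, with
finite error. -/
def IsOptimalCB (P : Measure ℝ) (r : ℝ) (α : Finset ℝ) : Prop :=
  qerr1 P r α ≠ ⊤ ∧
    ∀ β : Finset ℝ, β.Nonempty → β.card ≤ α.card → qerr1 P r α ≤ qerr1 P r β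

/-- The loss of deleting a point between two close points of an optimal codebook dominates the
gain of adding a point far away from the codebook. -/
lemma IsOptimalCB.exchange_density {f : ℝ → ℝ} {r : ℝ} (hr : 0 < r) {α : Finset ℝ}
    (hopt : IsOptimalCB (volume.withDensity fun x => ENNReal.ofReal (f x)) r α)
    {p q t : ℝ} (hp : p ∈ α) (hq : q ∈ α) (ht : t ∈ α) (hpq : p < q) (hqt : q < t)
    {y δ u v m m' : ℝ} (hδ : 0 ≤ δ) (hδD : δ ≤ infDist y (α : Set ℝ)) (huv : u ≤ v)
    (hI : Icc u v ⊆ closedBall y (infDist y (α : Set ℝ) / 4)) (hm : 0 ≤ m)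
    (hfm : ∀ x ∈ Icc u v, m ≤ f x) (hm' : 0 ≤ m') (hfm' : ∀ x ∈ Icc p t, f x ≤ m') :
    ((3 / 4) ^ r - (1 / 4) ^ r) * δ ^ r * (m * (v - u)) ≤ (t - p) ^ r * (m' * (t - p)) := by
  have hκ : 0 ≤ ((3 / 4 : ℝ) ^ r - (1 / 4) ^ r) :=
    sub_nonneg.2 (Real.rpow_le_rpow (by norm_num) (by norm_num) hr.le)
  have htp : 0 ≤ t - p := by linarith
  have hvu : 0 ≤ v - u := by linarith
  have h := qerr1_exchange hr hopt.1 hopt.2 hp hq ht hpq hqt y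
  have h1 := (withDensity_ge measurableSet_Icc hfm).trans (measure_mono hI)
  have h2 := withDensity_le measurableSet_Icc hfm'
  have h3 := (mul_le_mul' (ENNReal.ofReal_le_ofReal (mul_le_mul_of_nonneg_left
    (Real.rpow_le_rpow hδ hδD hr.le) hκ)) h1).trans (h.trans (mul_le_mul_right h2 _))
  rw [Real.volume_Icc, Real.volume_Icc, ← ENNReal.ofReal_mul hm, ← ENNReal.ofReal_mul hm',
    ← ENNReal.ofReal_mul (by positivity), ← ENNReal.ofReal_mul (by positivity)] at h3
  exact (ENNReal.ofReal_le_ofReal_iff (by positivity)).1 h3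

lemma setLIntegral_qdist1_ge {f : ℝ → ℝ} {r : ℝ} (hr : 0 < r) {α : Finset ℝ} (hα : α.Nonempty)
    {u v ε m : ℝ} (hε : 0 < ε) (hm : 0 ≤ m)
    (hN : 2 * ε * (α.filter fun x => x ∈ Ico (u - 2 * ε) (v + 2 * ε)).card ≤ (v - u) / 2)
    (hfm : ∀ x ∈ Icc u v, m ≤ f x) :
    ENNReal.ofReal (ε ^ r * (m * ((v - u) / 2))) ≤
      ∫⁻ x in Icc u v, ENNReal.ofReal (qdist1 x α) ^ r
        ∂(volume.withDensity fun x => ENNReal.ofReal (f x)) := by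
  set P := volume.withDensity fun x => ENNReal.ofReal (f x)
  set S := Icc u v ∩ {x | ε ≤ infDist x (α : Set ℝ)} with hS
  have hSm : MeasurableSet S :=
    measurableSet_Icc.inter (measurableSet_le measurable_const measurable_infDist)
  calc ENNReal.ofReal (ε ^ r * (m * ((v - u) / 2)))
      = ENNReal.ofReal (ε ^ r) * (ENNReal.ofReal m * ENNReal.ofReal ((v - u) / 2)) := by
        rw [ENNReal.ofReal_mul (by positivity), ENNReal.ofReal_mul hm]
    _ ≤ ENNReal.ofReal (ε ^ r) * P S := by
        gcongr
        refine le_trans ?_ (withDensity_ge hSm fun x hx => hfm x hx.1)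
        gcongr
        exact volume_far_ge hα hε hN
    _ = ∫⁻ x in S, ENNReal.ofReal (ε ^ r) ∂P := by rw [setLIntegral_const]
    _ ≤ ∫⁻ x in S, ENNReal.ofReal (qdist1 x α) ^ r ∂P := by
        refine setLIntegral_mono' hSm fun x hx => ?_
        rw [ENNReal.ofReal_rpow_of_nonneg (qdist1_nonneg _ _) hr.le]
        exact ENNReal.ofReal_le_ofReal (Real.rpow_le_rpow hε.le hx.2 hr.le)
    _ ≤ _ := lintegral_mono_set inter_subset_left

lemma lintegral_rpow_mul_exp {b c : ℝ} (hb : 0 < b) (hc : 0 < c) :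
    ∫⁻ x in Ioi (0 : ℝ), ENNReal.ofReal (x ^ (b - 1) * Real.exp (-(c * x))) =
      ENNReal.ofReal ((1 / c) ^ b * Real.Gamma b) := by
  have h := Real.integral_rpow_mul_exp_neg_mul_Ioi hb hc
  have hpos : 0 < (1 / c) ^ b * Real.Gamma b :=
    mul_pos (by positivity) (Real.Gamma_pos_of_pos hb)
  rw [← h, ofReal_integral_eq_lintegral_ofReal]
  · by_contra hn
    rw [integral_undef hn] at h
    exact hpos.ne h
  · filter_upwards [ae_restrict_mem measurableSet_Ioi] with x hx
    have : (0 : ℝ) < x := hx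
    simp only [Pi.zero_apply]
    positivity

lemma exists_codebook_infDist_le {c : ℝ} (hc : 0 < c) {n : ℕ} (hn : 1 ≤ n) :
    ∃ β : Finset ℝ, β.Nonempty ∧ β.card ≤ n ∧
      ∀ x : ℝ, 0 ≤ x → infDist x (β : Set ℝ) ≤ c / n * Real.exp (x / c) := by
  have hn0 : (0 : ℝ) < n := by exact_mod_cast hn
  refine ⟨(Finset.range n).image fun k : ℕ => c * Real.log (n / ((k : ℝ) + 1)), ?_, ?_, ?_⟩
  · exact Finset.Nonempty.image ⟨0, Finset.mem_range.2 hn⟩ _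
  · exact Finset.card_image_le.trans (by simp)
  · intro x hx
    set u := Real.exp (-(x / c)) with hu
    have hu0 : 0 < u := Real.exp_pos _
    have hu1 : u ≤ 1 := Real.exp_le_one_iff.2 (by have : 0 ≤ x / c := by positivity
                                                  linarith)
    obtain ⟨k, hk⟩ : ∃ k : ℕ, ⌈(n : ℝ) * u⌉₊ = k + 1 :=
      Nat.exists_eq_succ_of_ne_zero (Nat.ceil_pos.2 (by positivity)).ne'
    have hkn : k < n := by
      have : ⌈(n : ℝ) * u⌉₊ ≤ n := Nat.ceil_le.2 (by nlinarith)
      omega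
    have h1 : (n : ℝ) * u ≤ (k : ℝ) + 1 := by
      have := Nat.le_ceil ((n : ℝ) * u)
      rw [hk] at this
      exact_mod_cast this
    have h2 : (k : ℝ) + 1 < n * u + 1 := by
      have := Nat.ceil_lt_add_one (a := (n : ℝ) * u) (by positivity)
      rw [hk] at this
      exact_mod_cast this
    refine (infDist_le_dist_of_mem (y := c * Real.log (n / ((k : ℝ) + 1))) ?_).trans ?_
    · simp only [Finset.coe_image, Finset.coe_range, mem_image, mem_Iio]
      exact ⟨k, hkn, rfl⟩
    · have hk0 : (0 : ℝ) < (k : ℝ) + 1 := by positivity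
      have hxl : x - c * Real.log (n / ((k : ℝ) + 1)) =
          c * Real.log (((k : ℝ) + 1) / (n * u)) := by
        rw [Real.log_div hn0.ne' hk0.ne', Real.log_div hk0.ne' (by positivity),
          Real.log_mul hn0.ne' hu0.ne', hu, Real.log_exp]
        field_simp
        ring
      have hge : 1 ≤ ((k : ℝ) + 1) / (n * u) := by
        rw [le_div_iff₀ (by positivity)]; linarith
      have hle := Real.log_le_sub_one_of_pos (lt_of_lt_of_le one_pos hge)
      rw [Real.dist_eq, hxl, abs_of_nonneg (mul_nonneg hc.le (Real.log_nonneg hge))]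
      have : ((k : ℝ) + 1) / (n * u) - 1 ≤ 1 / (n * u) := by
        rw [div_sub_one (by positivity)]
        gcongr
        linarith
      calc _ ≤ c * (1 / (n * u)) := by gcongr; linarith
        _ = _ := by rw [hu, Real.exp_neg]; field_simp

lemma gammaDensity_of_pos (a l : ℝ) {x : ℝ} (hx : 0 < x) :
    gammaDensity a l x = l ^ a / Real.Gamma a * x ^ (a - 1) * Real.exp (-(l * x)) :=
  if_pos hx

lemma measurable_gammaDensity (a l : ℝ) : Measurable (gammaDensity a l) := by
  unfold gammaDensity
  refine Measurable.ite measurableSet_Ioi ?_ measurable_const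
  fun_prop

lemma gamma_const_pos {a l : ℝ} (ha : 0 < a) (hl : 0 < l) : 0 < l ^ a / Real.Gamma a :=
  div_pos (Real.rpow_pos_of_pos hl a) (Real.Gamma_pos_of_pos ha)

lemma lintegral_gamma_withDensity (a l : ℝ) {g : ℝ → ℝ≥0∞} (hg : Measurable g) :
    ∫⁻ x, g x ∂(volume.withDensity fun x => ENNReal.ofReal (gammaDensity a l x)) =
      ∫⁻ x in Ioi (0 : ℝ), ENNReal.ofReal
        (l ^ a / Real.Gamma a * x ^ (a - 1) * Real.exp (-(l * x))) * g x := by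
  rw [lintegral_withDensity_eq_lintegral_mul _ (measurable_gammaDensity a l).ennreal_ofReal hg,
    ← lintegral_indicator measurableSet_Ioi]
  refine lintegral_congr fun x => ?_
  by_cases hx : 0 < x
  · rw [indicator_of_mem (show x ∈ Ioi (0 : ℝ) from hx), Pi.mul_apply, gammaDensity_of_pos a l hx]
  · rw [indicator_of_notMem (show x ∉ Ioi (0 : ℝ) from hx), Pi.mul_apply, gammaDensity, if_neg hx]
    simp

lemma measurable_qdist1_rpow (α : Finset ℝ) (r : ℝ) :
    Measurable fun x => ENNReal.ofReal (qdist1 x α) ^ r :=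
  ((measurable_infDist).ennreal_ofReal).pow_const r

lemma rpow_le_two_rpow_abs_mul {b x y : ℝ} (hy : 0 < y) (hyx : y ≤ x) (hx : x ≤ 2 * y) :
    x ^ b ≤ 2 ^ |b| * y ^ b ∧ y ^ b ≤ 2 ^ |b| * x ^ b := by
  have hx0 : 0 < x := hy.trans_le hyx
  have hz1 : 1 ≤ x / y := by rwa [le_div_iff₀ hy, one_mul]
  have hz2 : x / y ≤ 2 := by rwa [div_le_iff₀ hy]
  have hz0 : 0 < x / y := by positivity
  have key : ∀ c : ℝ, |c| = |b| → (x / y) ^ c ≤ 2 ^ |b| := fun c hc =>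
    (Real.rpow_le_rpow_of_exponent_le hz1 ((le_abs_self c).trans hc.le)).trans
      (Real.rpow_le_rpow hz0.le hz2 (abs_nonneg b))
  constructor
  · calc x ^ b = (x / y) ^ b * y ^ b := by
          rw [← Real.mul_rpow hz0.le hy.le, div_mul_cancel₀ _ hy.ne']
      _ ≤ _ := by gcongr; exact key b rfl
  · calc y ^ b = (x / y) ^ (-b) * x ^ b := by
          rw [Real.rpow_neg hz0.le, Real.div_rpow hx0.le hy.le]
          have := (Real.rpow_pos_of_pos hx0 b).ne'
          field_simp
      _ ≤ _ := by gcongr; exact key (-b) (abs_neg b)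

lemma three_rpow_mul_min_le_rpow {b x y : ℝ} (hy : 0 < y) (hyx : y ≤ x) (hx : x ≤ 3) :
    3 ^ (-|b|) * min 1 (y ^ b) ≤ x ^ b := by
  have h3 : (3 : ℝ) ^ (-|b|) ≤ 1 :=
    Real.rpow_le_one_of_one_le_of_nonpos (by norm_num) (by simp)
  rcases le_or_gt 0 b with hb | hb
  · calc 3 ^ (-|b|) * min 1 (y ^ b) ≤ 1 * y ^ b := by
          gcongr
          exact min_le_right _ _
      _ ≤ x ^ b := by rw [one_mul]; gcongr
  · calc 3 ^ (-|b|) * min 1 (y ^ b) ≤ 3 ^ (-|b|) * 1 := by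
          gcongr
          exact min_le_left _ _
      _ = 3 ^ b := by rw [mul_one, abs_of_neg hb, neg_neg]
      _ ≤ x ^ b := Real.rpow_le_rpow_of_nonpos (hy.trans_le hyx) hx hb.le

lemma gammaDensity_ge {a l x y : ℝ} (ha : 0 < a) (hl : 0 < l) (hy : 0 < y) (hyx : y ≤ x)
    (hx : x ≤ 2 * y) :
    l ^ a / Real.Gamma a * (2 ^ (-|a - 1|) * y ^ (a - 1)) * Real.exp (-(l * x)) ≤
      gammaDensity a l x := by
  have := gamma_const_pos ha hl
  rw [gammaDensity_of_pos a l (hy.trans_le hyx)]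
  gcongr
  rw [Real.rpow_neg (by norm_num), inv_mul_le_iff₀ (by positivity)]
  exact (rpow_le_two_rpow_abs_mul hy hyx hx).2

lemma gammaDensity_le {a l x y : ℝ} (ha : 0 < a) (hl : 0 < l) (hy : 0 < y) (hyx : y ≤ x)
    (hx : x ≤ 2 * y) :
    gammaDensity a l x ≤
      l ^ a / Real.Gamma a * (2 ^ |a - 1| * y ^ (a - 1)) * Real.exp (-(l * y)) := by
  have := gamma_const_pos ha hl
  rw [gammaDensity_of_pos a l (hy.trans_le hyx)]
  gcongr
  exact (rpow_le_two_rpow_abs_mul hy hyx hx).1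

lemma OptimalSeq1.qerr1_le {P : Measure ℝ} {r : ℝ} (hr : 0 < r) {α : ℕ → Finset ℝ}
    (hα : OptimalSeq1 P r α) {n : ℕ} (hn : 1 ≤ n) {β : Finset ℝ} (hβ : β.Nonempty)
    (hc : β.card ≤ n) : qerr1 P r (α n) ≤ qerr1 P r β := by
  rw [(hα n hn).2.2]
  have h : enr1 P r n ≤ qerr1 P r β ^ (1 / r) := iInf_le_of_le β (iInf₂_le hβ hc)
  refine (ENNReal.rpow_le_rpow h hr.le).trans ?_
  rw [← ENNReal.rpow_mul, one_div_mul_cancel hr.ne', ENNReal.rpow_one]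

lemma OptimalSeq1.exists_qerr1_le_gamma {r a l : ℝ} (hr : 0 < r) (ha : 0 < a) (hl : 0 < l)
    {α : ℕ → Finset ℝ}
    (hα : OptimalSeq1 (volume.withDensity fun x => ENNReal.ofReal (gammaDensity a l x)) r α) :
    ∃ K : ℝ, 0 < K ∧ ∀ n : ℕ, 1 ≤ n →
      qerr1 (volume.withDensity fun x => ENNReal.ofReal (gammaDensity a l x)) r (α n) ≤
        ENNReal.ofReal (K * (1 / n) ^ r) := by
  have hG := gamma_const_pos ha hl
  have hΓ := Real.Gamma_pos_of_pos ha
  set c := 2 * r / l with hc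
  have hc0 : 0 < c := by positivity
  refine ⟨c ^ r * (l ^ a / Real.Gamma a) * ((1 / (l / 2)) ^ a * Real.Gamma a), by positivity,
    fun n hn => ?_⟩
  have hn0 : (0 : ℝ) < n := by exact_mod_cast hn
  obtain ⟨β, hβ, hcard, hd⟩ := exists_codebook_infDist_le hc0 hn
  refine (hα.qerr1_le hr hn hβ hcard).trans ?_
  rw [qerr1, lintegral_gamma_withDensity a l (measurable_qdist1_rpow β r)]
  calc _ ≤ ∫⁻ x in Ioi (0 : ℝ), ENNReal.ofReal (c ^ r * (l ^ a / Real.Gamma a) * (1 / n) ^ r) *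
          ENNReal.ofReal (x ^ (a - 1) * Real.exp (-((l / 2) * x))) := by
        refine setLIntegral_mono' measurableSet_Ioi fun x hx => ?_
        have hx0 : (0 : ℝ) < x := hx
        rw [ENNReal.ofReal_rpow_of_nonneg (qdist1_nonneg _ _) hr.le,
          ← ENNReal.ofReal_mul (by positivity), ← ENNReal.ofReal_mul (by positivity)]
        apply ENNReal.ofReal_le_ofReal
        have h1 : qdist1 x β ^ r ≤ (c / n * Real.exp (x / c)) ^ r :=
          Real.rpow_le_rpow (qdist1_nonneg _ _) (hd x hx0.le) hr.le
        have h2 : (c / n * Real.exp (x / c)) ^ r = c ^ r * (1 / n) ^ r * Real.exp (l / 2 * x) := by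
          rw [div_eq_mul_one_div, Real.mul_rpow (by positivity) (by positivity),
            Real.mul_rpow (by positivity) (by positivity), ← Real.exp_mul]
          congr 2
          rw [hc]; field_simp
        have h3 : Real.exp (-(l * x)) * Real.exp (l / 2 * x) = Real.exp (-((l / 2) * x)) := by
          rw [← Real.exp_add]; congr 1; ring
        rw [h2] at h1
        calc _ ≤ l ^ a / Real.Gamma a * x ^ (a - 1) * Real.exp (-(l * x)) *
              (c ^ r * (1 / n) ^ r * Real.exp (l / 2 * x)) := by gcongr
          _ = _ := by rw [← h3]; ring
    _ = _ := by
        rw [lintegral_const_mul' _ _ ENNReal.ofReal_ne_top, lintegral_rpow_mul_exp ha (by positivity),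
          ← ENNReal.ofReal_mul (by positivity)]
        congr 1; ring

lemma OptimalSeq1.isOptimalCB_gamma {r a l : ℝ} (hr : 0 < r) (ha : 0 < a) (hl : 0 < l)
    {α : ℕ → Finset ℝ}
    (hα : OptimalSeq1 (volume.withDensity fun x => ENNReal.ofReal (gammaDensity a l x)) r α)
    {n : ℕ} (hn : 1 ≤ n) :
    IsOptimalCB (volume.withDensity fun x => ENNReal.ofReal (gammaDensity a l x)) r (α n) := by
  obtain ⟨K, -, hK⟩ := hα.exists_qerr1_le_gamma hr ha hl
  exact ⟨((hK n hn).trans_lt ENNReal.ofReal_lt_top).ne,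
    fun β hβ hc => hα.qerr1_le hr hn hβ (hc.trans (hα n hn).2.1)⟩

lemma OptimalSeq1.exists_close_triple_gamma {r a l : ℝ} (hr : 0 < r) (ha : 0 < a) (hl : 0 < l)
    {α : ℕ → Finset ℝ}
    (hα : OptimalSeq1 (volume.withDensity fun x => ENNReal.ofReal (gammaDensity a l x)) r α) :
    ∃ C : ℝ, 0 < C ∧ ∃ N₀ : ℕ, 1 ≤ N₀ ∧ ∀ n ≥ N₀, ∃ p ∈ α n, ∃ q ∈ α n, ∃ t ∈ α n,
      p < q ∧ q < t ∧ 1 ≤ p ∧ t < 2 ∧ t - p ≤ C / n := by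
  have hG := gamma_const_pos ha hl
  obtain ⟨K, hK0, hK⟩ := hα.exists_qerr1_le_gamma hr ha hl
  set m := l ^ a / Real.Gamma a * (2 ^ (-|a - 1|) * 1 ^ (a - 1)) * Real.exp (-(l * 2)) with hm
  have hm0 : 0 < m := by positivity
  have hfm : ∀ x ∈ Icc (5 / 4 : ℝ) (7 / 4), m ≤ gammaDensity a l x := fun x hx => by
    refine le_trans ?_ (gammaDensity_ge ha hl one_pos (by linarith [hx.1]) (by linarith [hx.2]))
    rw [hm]
    gcongr
    linarith [hx.2]
  set A := (4 * K / m) ^ (1 / r) with hA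
  have hA0 : 0 < A := by positivity
  refine ⟨40 * A, by positivity, ⌈32 * A⌉₊ + 1, by omega, fun n hn => ?_⟩
  have hn1 : 1 ≤ n := by omega
  have hn0 : (0 : ℝ) < n := by exact_mod_cast hn1
  have hnA : 32 * A < n := by
    have h1 := Nat.le_ceil (32 * A)
    have h2 : ((⌈32 * A⌉₊ + 1 : ℕ) : ℝ) ≤ n := by exact_mod_cast hn
    push_cast at h2
    linarith
  set N := ((α n).filter fun x => x ∈ Ico (1 : ℝ) 2).card with hN
  set ε : ℝ := 1 / (8 * (N + 1)) with hε
  have hε0 : 0 < ε := by positivity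
  have hε8 : ε ≤ 1 / 8 := by
    rw [hε]
    gcongr
    have : (0 : ℝ) ≤ N := by positivity
    linarith
  have hεN : ε * (8 * (N + 1)) = 1 := by rw [hε]; field_simp
  have hcard : ((α n).filter fun x => x ∈ Ico (5 / 4 - 2 * ε) (7 / 4 + 2 * ε)).card ≤ N := by
    refine Finset.card_le_card fun x hx => ?_
    simp only [Finset.mem_filter, mem_Ico] at hx ⊢
    exact ⟨hx.1, by linarith [hx.2.1], by linarith [hx.2.2]⟩
  have hcard' : (((α n).filter fun x => x ∈ Ico (5 / 4 - 2 * ε) (7 / 4 + 2 * ε)).card : ℝ) ≤ N := by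
    exact_mod_cast hcard
  have hlow := setLIntegral_qdist1_ge hr (hα n hn1).1 hε0 hm0.le (u := 5 / 4) (v := 7 / 4)
    (by nlinarith) hfm
  have hle := (hlow.trans (setLIntegral_le_lintegral _ _)).trans (hK n hn1)
  rw [ENNReal.ofReal_le_ofReal_iff (by positivity)] at hle
  have hnε : n * ε ≤ A := by
    have h1 : (n * ε) ^ r ≤ 4 * K / m := by
      rw [Real.mul_rpow hn0.le hε0.le, le_div_iff₀ hm0]
      have h2 : (n : ℝ) ^ r * (1 / n) ^ r = 1 := by
        rw [← Real.mul_rpow hn0.le (by positivity), mul_one_div_cancel hn0.ne', Real.one_rpow]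
      have h3 := mul_le_mul_of_nonneg_left hle (Real.rpow_nonneg hn0.le r)
      have h4 : (n : ℝ) ^ r * (K * (1 / n) ^ r) = K := by linear_combination K * h2
      rw [h4] at h3
      nlinarith
    have h5 := Real.rpow_le_rpow (by positivity) h1 (show 0 ≤ 1 / r by positivity)
    rwa [← Real.rpow_mul (by positivity), mul_one_div_cancel hr.ne', Real.rpow_one] at h5
  have hnN : (n : ℝ) ≤ 8 * A * (N + 1) := by
    calc (n : ℝ) = n * ε * (8 * (N + 1)) := by rw [mul_assoc, hεN, mul_one]
      _ ≤ A * (8 * (N + 1)) := by gcongr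
      _ = _ := by ring
  have hN3 : 3 < N := by
    have : (3 : ℝ) < N := by
      by_contra h
      nlinarith
    exact_mod_cast this
  obtain ⟨p, hp, q, hq, t, ht, hpq, hqt, h1p, ht2, htp⟩ :=
    exists_close_triple (α := α n) (u := 1) (v := 2) one_lt_two (M := (N - 1) / 2) (by omega)
      (by rw [← hN]; omega)
  refine ⟨p, hp, q, hq, t, ht, hpq, hqt, h1p, ht2, htp.trans ?_⟩
  have hM : (N : ℝ) + 1 ≤ 5 * ((N - 1) / 2 : ℕ) := by
    have : N + 1 ≤ 5 * ((N - 1) / 2) := by omega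
    exact_mod_cast this
  have hM0 : (0 : ℝ) < ((N - 1) / 2 : ℕ) := by
    have : 0 < (N - 1) / 2 := by omega
    exact_mod_cast this
  rw [div_le_div_iff₀ hM0 hn0]
  nlinarith

/-- Lower bound for the density near `y`, on an interval of length `δ / 4` within distance `δ / 4`
of `y`. -/
lemma exists_Icc_gammaDensity_ge {a l y δ : ℝ} (ha : 0 < a) (hl : 0 < l) (hy : 0 < y)
    (hδ : δ ≤ max 2 y) :
    ∃ u v : ℝ, v - u = δ / 4 ∧ Icc u v ⊆ closedBall y (δ / 4) ∧
      ∀ x ∈ Icc u v, l ^ a / Real.Gamma a * 3 ^ (-|a - 1|) * Real.exp (-(l * 3)) *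
        (min 1 (y ^ (a - 1)) * Real.exp (-(l * y))) ≤ gammaDensity a l x := by
  have hG := gamma_const_pos ha hl
  rcases le_or_gt y 2 with hy2 | hy2
  · rw [max_eq_left hy2] at hδ
    refine ⟨y, y + δ / 4, by ring, fun x hx => ?_, fun x hx => ?_⟩
    · rw [mem_closedBall, Real.dist_eq, abs_of_nonneg (by linarith [hx.1])]
      linarith [hx.2]
    · have hx0 : 0 < x := hy.trans_le hx.1
      have hx3 : x ≤ 3 := by linarith [hx.2]
      rw [gammaDensity_of_pos a l hx0]
      calc _ = l ^ a / Real.Gamma a * (3 ^ (-|a - 1|) * min 1 (y ^ (a - 1))) *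
            (Real.exp (-(l * 3)) * Real.exp (-(l * y))) := by ring
        _ ≤ l ^ a / Real.Gamma a * x ^ (a - 1) * (Real.exp (-(l * x)) * 1) := by
          gcongr
          · exact three_rpow_mul_min_le_rpow hy hx.1 hx3
          · exact Real.exp_le_one_iff.2 (by have := mul_pos hl hy; linarith)
        _ = _ := by ring
  · rw [max_eq_right hy2.le] at hδ
    refine ⟨y - δ / 4, y, by ring, fun x hx => ?_, fun x hx => ?_⟩
    · rw [mem_closedBall, Real.dist_eq, abs_of_nonpos (by linarith [hx.2])]
      linarith [hx.1]
    · have hxy : y ≤ 2 * x := by linarith [hx.1]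
      have hx0 : 0 < x := by linarith
      rw [gammaDensity_of_pos a l hx0]
      have h1 : 3 ^ (-|a - 1|) * min 1 (y ^ (a - 1)) ≤ x ^ (a - 1) := by
        calc 3 ^ (-|a - 1|) * min 1 (y ^ (a - 1)) ≤ 2 ^ (-|a - 1|) * y ^ (a - 1) := by
              gcongr ?_ * ?_
              · exact Real.rpow_le_rpow_of_nonpos (by norm_num) (by norm_num) (by simp)
              · exact min_le_right _ _
          _ ≤ x ^ (a - 1) := by
              rw [Real.rpow_neg (by norm_num), inv_mul_le_iff₀ (by positivity)]
              exact (rpow_le_two_rpow_abs_mul hx0 hx.2 hxy).1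
      calc _ = l ^ a / Real.Gamma a * (3 ^ (-|a - 1|) * min 1 (y ^ (a - 1))) *
            (Real.exp (-(l * y)) * Real.exp (-(l * 3))) := by ring
        _ ≤ l ^ a / Real.Gamma a * x ^ (a - 1) * (Real.exp (-(l * x)) * 1) := by
          gcongr
          · exact hx.2
          · exact Real.exp_le_one_iff.2 (by linarith)
        _ = _ := by ring

lemma sub_rpow_pos {r : ℝ} (hr : 0 < r) : 0 < ((3 / 4 : ℝ) ^ r - (1 / 4) ^ r) :=
  sub_pos.2 (Real.rpow_lt_rpow (by norm_num) (by norm_num) hr)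

lemma min_one_rpow_neg_le {z p : ℝ} (hz : 0 < z) : (min 1 z) ^ (-p) ≤ 1 + z ^ (-p) := by
  rcases min_cases 1 z with ⟨h, -⟩ | ⟨h, -⟩ <;> rw [h]
  · rw [Real.one_rpow]; have := Real.rpow_pos_of_pos hz (-p); linarith
  · linarith

/-- Pointwise bound for the distance to an optimal codebook of the Gamma distribution. -/
lemma OptimalSeq1.exists_infDist_rpow_le_gamma {r s a l : ℝ} (hr : 0 < r) (hs : 0 < s)
    (ha : 0 < a) (hl : 0 < l) {α : ℕ → Finset ℝ}
    (hα : OptimalSeq1 (volume.withDensity fun x => ENNReal.ofReal (gammaDensity a l x)) r α) :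
    ∃ C : ℝ, 0 < C ∧ ∃ N₀ : ℕ, 1 ≤ N₀ ∧ ∀ n ≥ N₀, ∀ y : ℝ, 0 < y →
      infDist y (α n : Set ℝ) ^ s ≤ C * (1 / n) ^ s *
        ((1 + y ^ (-((a - 1) * (s / (r + 1))))) * Real.exp (l * (s / (r + 1)) * y)) := by
  have hG := gamma_const_pos ha hl
  obtain ⟨C, hC, N₀, hN₀, H⟩ := hα.exists_close_triple_gamma hr ha hl
  set κ := ((3 / 4 : ℝ) ^ r - (1 / 4) ^ r) with hκ
  have hκ0 : 0 < κ := sub_rpow_pos hr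
  set c := l ^ a / Real.Gamma a * 3 ^ (-|a - 1|) * Real.exp (-(l * 3)) with hc
  have hc0 : 0 < c := by positivity
  set m' := l ^ a / Real.Gamma a * (2 ^ |a - 1| * 1 ^ (a - 1)) * Real.exp (-(l * 1)) with hm'
  have hm'0 : 0 < m' := by positivity
  set B := 4 * m' * C ^ (r + 1) / (κ * c) with hB
  have hB0 : 0 < B := by positivity
  refine ⟨B ^ (s / (r + 1)), by positivity, N₀, hN₀, fun n hn y hy => ?_⟩
  have hn1 : 1 ≤ n := hN₀.trans hn
  have hn0 : (0 : ℝ) < n := by exact_mod_cast hn1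
  obtain ⟨p, hp, q, hq, t, ht, hpq, hqt, h1p, ht2, htp⟩ := H n hn
  set D := infDist y (α n : Set ℝ) with hD
  have hD0 : 0 ≤ D := infDist_nonneg
  set g := min 1 (y ^ (a - 1)) * Real.exp (-(l * y)) with hg
  have hmin : 0 < min 1 (y ^ (a - 1)) := lt_min one_pos (by positivity)
  have hg0 : 0 < g := by positivity
  have hDmax : D ≤ max 2 y := by
    have h1 : D ≤ |y - p| := (infDist_le_dist_of_mem (Finset.mem_coe.2 hp))
    refine h1.trans (abs_le.2 ⟨?_, ?_⟩)
    · linarith [le_max_left 2 y]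
    · linarith [le_max_right 2 y]
  obtain ⟨u, v, huv, hsub, hf⟩ := exists_Icc_gammaDensity_ge ha hl hy hDmax
  have key := (hα.isOptimalCB_gamma hr ha hl hn1).exchange_density hr hp hq ht hpq hqt
    (y := y) hD0 le_rfl (by linarith : u ≤ v) hsub (by positivity : 0 ≤ c * g) hf hm'0.le
    (fun x hx => gammaDensity_le ha hl one_pos (h1p.trans hx.1) (by linarith [hx.2]))
  rw [huv, ← hκ] at key
  have htp0 : 0 ≤ t - p := by linarith
  have h1 : D ^ (r + 1) ≤ B * (1 / n) ^ (r + 1) / g := by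
    rw [le_div_iff₀ hg0, hB, div_mul_eq_mul_div, le_div_iff₀ (by positivity)]
    have h2 : (t - p) ^ (r + 1) ≤ C ^ (r + 1) * (1 / n) ^ (r + 1) := by
      rw [← Real.mul_rpow hC.le (by positivity), mul_one_div]
      exact Real.rpow_le_rpow htp0 htp (by linarith)
    have h3 : D ^ (r + 1) = D ^ r * D := Real.rpow_add_one' hD0 (by linarith)
    have h4 : (t - p) ^ (r + 1) = (t - p) ^ r * (t - p) := Real.rpow_add_one' htp0 (by linarith)
    calc D ^ (r + 1) * g * (κ * c) = 4 * (κ * D ^ r * (c * g * (D / 4))) := by rw [h3]; ring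
      _ ≤ 4 * ((t - p) ^ r * (m' * (t - p))) := by gcongr
      _ = 4 * m' * (t - p) ^ (r + 1) := by rw [h4]; ring
      _ ≤ 4 * m' * (C ^ (r + 1) * (1 / n) ^ (r + 1)) := by gcongr
      _ = _ := by ring
  have hr1 : r + 1 ≠ 0 := by linarith
  have hexp : (r + 1) * (s / (r + 1)) = s := by field_simp
  calc D ^ s = (D ^ (r + 1)) ^ (s / (r + 1)) := by rw [← Real.rpow_mul hD0, hexp]
    _ ≤ (B * (1 / n) ^ (r + 1) / g) ^ (s / (r + 1)) :=
        Real.rpow_le_rpow (by positivity) h1 (by positivity)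
    _ = B ^ (s / (r + 1)) * (1 / n) ^ s * g ^ (-(s / (r + 1))) := by
        rw [Real.div_rpow (by positivity) hg0.le, Real.mul_rpow hB0.le (by positivity),
          ← Real.rpow_mul (by positivity), hexp, Real.rpow_neg hg0.le, div_eq_mul_inv]
    _ ≤ _ := by
        gcongr
        rw [hg, Real.mul_rpow hmin.le (Real.exp_pos _).le, ← Real.exp_mul]
        have h5 : -(l * y) * -(s / (r + 1)) = l * (s / (r + 1)) * y := by ring
        rw [h5]
        gcongr
        refine (min_one_rpow_neg_le (by positivity)).trans_eq ?_
        rw [← Real.rpow_mul hy.le]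
        congr 2
        ring

open scoped Pointwise in
lemma qdist1_scaleCB {θ : ℝ} (hθ : 0 < θ) (x : ℝ) (α : Finset ℝ) :
    qdist1 x (scaleCB θ α) = θ * infDist (x / θ) (α : Set ℝ) := by
  have h : ((scaleCB θ α : Finset ℝ) : Set ℝ) = θ • (α : Set ℝ) := by
    ext z; simp [scaleCB, mem_smul_set]
  have hx : x = θ • (x / θ) := by rw [smul_eq_mul, mul_div_cancel₀ _ hθ.ne']
  rw [qdist1, h]
  conv_lhs => rw [hx]
  rw [infDist_smul₀ hθ.ne', Real.norm_of_nonneg hθ.le]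

lemma OptimalSeq1.rateOptimal1_scaleCB_gamma {r s a l : ℝ} (hr : 0 < r) (hs : 0 < s)
    (hs' : s < r + 1) (ha : 0 < a) (hl : 0 < l) {α : ℕ → Finset ℝ}
    (hα : OptimalSeq1 (volume.withDensity fun x => ENNReal.ofReal (gammaDensity a l x)) r α)
    {θ : ℝ} (hθ : s / (r + 1) < θ) :
    RateOptimal1 (volume.withDensity fun x => ENNReal.ofReal (gammaDensity a l x)) s
      (fun n => scaleCB θ (α n)) := by
  have hG := gamma_const_pos ha hl
  obtain ⟨C, hC, N₀, hN₀, H⟩ := hα.exists_infDist_rpow_le_gamma hr hs ha hl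
  set p := s / (r + 1) with hp
  have hp0 : 0 < p := by positivity
  have hp1 : p < 1 := (div_lt_one (by linarith)).2 hs'
  have hθ0 : 0 < θ := hp0.trans hθ
  set c := l * (1 - p / θ) with hc
  have hc0 : 0 < c := mul_pos hl (sub_pos.2 ((div_lt_one hθ0).2 hθ))
  set b := a - (a - 1) * p with hb
  have hb0 : 0 < b := by rw [hb]; nlinarith
  set A := θ ^ s * C * (l ^ a / Real.Gamma a) with hA
  have hA0 : 0 < A := by positivity
  set I := ENNReal.ofReal A * (ENNReal.ofReal ((1 / c) ^ a * Real.Gamma a) +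
    ENNReal.ofReal (θ ^ ((a - 1) * p)) * ENNReal.ofReal ((1 / c) ^ b * Real.Gamma b)) with hI
  have hItop : I < ⊤ := by
    rw [hI]
    exact ENNReal.mul_lt_top ENNReal.ofReal_lt_top (ENNReal.add_lt_top.2 ⟨ENNReal.ofReal_lt_top,
      ENNReal.mul_lt_top ENNReal.ofReal_lt_top ENNReal.ofReal_lt_top⟩)
  refine lt_of_le_of_lt ?_ hItop
  refine limsup_le_of_le (by isBoundedDefault) ?_
  filter_upwards [eventually_ge_atTop N₀] with n hn
  have hn1 : 1 ≤ n := hN₀.trans hn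
  have hn0 : (0 : ℝ) < n := by exact_mod_cast hn1
  have hns : (n : ℝ) ^ s * (1 / n) ^ s = 1 := by
    rw [← Real.mul_rpow hn0.le (by positivity), mul_one_div_cancel hn0.ne', Real.one_rpow]
  have hmeas : ∀ d : ℝ, Measurable fun x : ℝ =>
      ENNReal.ofReal (x ^ (d - 1) * Real.exp (-(c * x))) := fun d => by fun_prop
  rw [qerr1, lintegral_gamma_withDensity a l (measurable_qdist1_rpow _ s),
    ← ENNReal.ofReal_natCast, ENNReal.ofReal_rpow_of_pos hn0,
    ← lintegral_const_mul' _ _ ENNReal.ofReal_ne_top, hI, ← lintegral_rpow_mul_exp ha hc0,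
    ← lintegral_rpow_mul_exp hb0 hc0, ← lintegral_const_mul _ (hmeas b),
    ← lintegral_add_left (hmeas a), ← lintegral_const_mul' _ _ ENNReal.ofReal_ne_top]
  refine setLIntegral_mono' measurableSet_Ioi fun x hx => ?_
  have hx0 : (0 : ℝ) < x := hx
  rw [qdist1_scaleCB hθ0, ENNReal.ofReal_rpow_of_nonneg (mul_nonneg hθ0.le infDist_nonneg) hs.le,
    ← ENNReal.ofReal_mul (by positivity), ← ENNReal.ofReal_mul (by positivity),
    ← ENNReal.ofReal_mul (by positivity), ← ENNReal.ofReal_add (by positivity) (by positivity),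
    ← ENNReal.ofReal_mul hA0.le]
  apply ENNReal.ofReal_le_ofReal
  rw [Real.mul_rpow hθ0.le infDist_nonneg]
  have h1 := H n hn (x / θ) (by positivity)
  have h2 : (x / θ) ^ (-((a - 1) * p)) = θ ^ ((a - 1) * p) * x ^ (-((a - 1) * p)) := by
    rw [Real.div_rpow hx0.le hθ0.le, Real.rpow_neg hθ0.le, div_inv_eq_mul, mul_comm]
  have h3 : x ^ (b - 1) = x ^ (a - 1) * x ^ (-((a - 1) * p)) := by
    rw [← Real.rpow_add hx0]; congr 1; rw [hb]; ring
  have h4 : Real.exp (-(c * x)) = Real.exp (-(l * x)) * Real.exp (l * p * (x / θ)) := by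
    rw [← Real.exp_add]; congr 1; rw [hc]; field_simp; ring
  calc _ ≤ (n : ℝ) ^ s * (l ^ a / Real.Gamma a * x ^ (a - 1) * Real.exp (-(l * x)) *
        (θ ^ s * (C * (1 / n) ^ s * ((1 + (x / θ) ^ (-((a - 1) * p))) *
          Real.exp (l * p * (x / θ)))))) := by gcongr
    _ = (n : ℝ) ^ s * (1 / n) ^ s * (l ^ a / Real.Gamma a * x ^ (a - 1) * Real.exp (-(l * x)) *
        (θ ^ s * (C * ((1 + (x / θ) ^ (-((a - 1) * p))) *
          Real.exp (l * p * (x / θ)))))) := by ring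
    _ = _ := by rw [hns, h2, h3, h4, hA]; ring

/-- The loss of deleting a point of an optimal codebook is at least of order `n ^ (-(r + 1))`. -/
lemma OptimalSeq1.exists_le_loss_gamma {r a l : ℝ} (hr : 0 < r) (ha : 0 < a) (hl : 0 < l)
    {α : ℕ → Finset ℝ}
    (hα : OptimalSeq1 (volume.withDensity fun x => ENNReal.ofReal (gammaDensity a l x)) r α) :
    ∃ c : ℝ, 0 < c ∧ ∀ n : ℕ, 1 ≤ n → ∀ p ∈ α n, ∀ q ∈ α n, ∀ t ∈ α n, p < q → q < t →
      ∀ m' : ℝ, 0 ≤ m' → (∀ x ∈ Icc p t, gammaDensity a l x ≤ m') →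
        c * (1 / n) ^ (r + 1) ≤ m' * (t - p) ^ (r + 1) := by
  have hG := gamma_const_pos ha hl
  have hκ0 : 0 < ((3 / 4 : ℝ) ^ r - (1 / 4) ^ r) := sub_rpow_pos hr
  set κ := ((3 / 4 : ℝ) ^ r - (1 / 4) ^ r) with hκ
  set m := l ^ a / Real.Gamma a * (2 ^ (-|a - 1|) * 1 ^ (a - 1)) * Real.exp (-(l * 2)) with hm
  have hm0 : 0 < m := by positivity
  refine ⟨κ * m / 4 * (1 / 8) ^ (r + 1), by positivity,
    fun n hn p hp q hq t ht hpq hqt m' hm' hfm' => ?_⟩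
  have hn0 : (0 : ℝ) < n := by exact_mod_cast hn
  have hn1 : (1 : ℝ) ≤ n := by exact_mod_cast hn
  set ε : ℝ := 1 / 8 * (1 / n) with hε
  have hε0 : 0 < ε := by positivity
  have hεn : ε * n = 1 / 8 := by rw [hε]; field_simp
  have hε8 : ε ≤ 1 / 8 := by nlinarith
  obtain ⟨y, hy, hyε⟩ : (Icc (5 / 4 : ℝ) (7 / 4) ∩
      {x | ε ≤ infDist x (α n : Set ℝ)}).Nonempty := by
    refine nonempty_of_measure_ne_zero (μ := volume) (ne_of_gt (lt_of_lt_of_le ?_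
      (volume_far_ge (hα n hn).1 hε0 ?_)))
    · exact ENNReal.ofReal_pos.2 (by norm_num)
    · have h1 : ((α n).filter fun x => x ∈ Ico (5 / 4 - 2 * ε) (7 / 4 + 2 * ε)).card ≤ n :=
        (Finset.card_filter_le _ _).trans (hα n hn).2.1
      have h2 : (((α n).filter
        fun x => x ∈ Ico (5 / 4 - 2 * ε) (7 / 4 + 2 * ε)).card : ℝ) ≤ n := by exact_mod_cast h1
      nlinarith
  have hyε' : ε ≤ infDist y (α n : Set ℝ) := hyε
  have key := (hα.isOptimalCB_gamma hr ha hl hn).exchange_density hr hp hq ht hpq hqt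
    (y := y) hε0.le hyε' (by linarith : y ≤ y + ε / 4) (fun x hx => by
      rw [mem_closedBall, Real.dist_eq, abs_of_nonneg (by linarith [hx.1])]
      linarith [hx.2]) hm0.le (fun x hx => by
      refine le_trans ?_ (gammaDensity_ge ha hl one_pos (by linarith [hx.1, hy.1])
        (by linarith [hx.2, hy.2]))
      rw [hm]
      gcongr
      linarith [hx.2, hy.2]) hm' hfm'
  have htp0 : 0 ≤ t - p := by linarith
  have h3 : ε ^ (r + 1) = ε ^ r * ε := Real.rpow_add_one' hε0.le (by linarith)
  have h4 : (t - p) ^ (r + 1) = (t - p) ^ r * (t - p) := Real.rpow_add_one' htp0 (by linarith)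
  calc _ = κ * m / 4 * ε ^ (r + 1) := by
        rw [hε, Real.mul_rpow (by norm_num) (by positivity)]; ring
    _ = κ * ε ^ r * (m * (y + ε / 4 - y)) := by rw [h3]; ring
    _ ≤ _ := key
    _ = _ := by rw [h4]; ring

lemma OptimalSeq1.exists_card_le_gamma {r a l : ℝ} (hr : 0 < r) (ha : 0 < a) (hl : 0 < l)
    {α : ℕ → Finset ℝ}
    (hα : OptimalSeq1 (volume.withDensity fun x => ENNReal.ofReal (gammaDensity a l x)) r α) :
    ∃ C : ℝ, 0 < C ∧ ∀ n : ℕ, 1 ≤ n → ∀ k : ℕ, 1 ≤ k →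
      (((α n).filter fun x => x ∈ Ico (k : ℝ) (k + 1)).card : ℝ) ≤
        C * n * ((k : ℝ) ^ (a - 1) * Real.exp (-(l * k))) ^ (1 / (r + 1)) + 2 := by
  have hG := gamma_const_pos ha hl
  obtain ⟨c, hc, H⟩ := hα.exists_le_loss_gamma hr ha hl
  set B := l ^ a / Real.Gamma a * 2 ^ |a - 1| / c with hB
  have hB0 : 0 < B := by positivity
  have hr1 : 0 < r + 1 := by linarith
  refine ⟨2 * B ^ (1 / (r + 1)), by positivity, fun n hn k hk => ?_⟩
  have hn0 : (0 : ℝ) < n := by exact_mod_cast hn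
  have hk1 : (1 : ℝ) ≤ k := by exact_mod_cast hk
  have hk0 : (0 : ℝ) < k := by linarith
  set h := (k : ℝ) ^ (a - 1) * Real.exp (-(l * k)) with hh
  have hh0 : 0 < h := by positivity
  set X := B ^ (1 / (r + 1)) * n * h ^ (1 / (r + 1)) with hX
  have hX0 : 0 < X := by positivity
  suffices hcard : ((α n).filter fun x => x ∈ Ico (k : ℝ) (k + 1)).card ≤ 2 * (⌊X⌋₊ + 1) by
    have h1 : (((α n).filter fun x => x ∈ Ico (k : ℝ) (k + 1)).card : ℝ) ≤ 2 * (⌊X⌋₊ + 1) := by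
      exact_mod_cast hcard
    have h2 := Nat.floor_le hX0.le
    calc _ ≤ 2 * ((⌊X⌋₊ : ℝ) + 1) := h1
      _ ≤ 2 * (X + 1) := by gcongr
      _ = _ := by rw [hX]; ring
  by_contra! hcard
  obtain ⟨p, hp, q, hq, t, ht, hpq, hqt, hkp, htk, htp⟩ :=
    exists_close_triple (by linarith : (k : ℝ) < k + 1) (by omega : 1 ≤ ⌊X⌋₊ + 1) hcard
  have hXM : X < ((⌊X⌋₊ + 1 : ℕ) : ℝ) := by push_cast; exact Nat.lt_floor_add_one X
  set M := ⌊X⌋₊ + 1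
  have hM0 : (0 : ℝ) < M := hX0.trans hXM
  have key := H n hn p hp q hq t ht hpq hqt
    (l ^ a / Real.Gamma a * (2 ^ |a - 1| * (k : ℝ) ^ (a - 1)) * Real.exp (-(l * k)))
    (by positivity)
    (fun x hx => gammaDensity_le ha hl hk0 (hkp.trans hx.1) (by linarith [hx.2]))
  have h1 : (t - p) ^ (r + 1) ≤ (1 / M) ^ (r + 1) := by
    refine Real.rpow_le_rpow (by linarith) (htp.trans_eq ?_) hr1.le
    rw [add_sub_cancel_left]
  have h2 : c * (1 / n) ^ (r + 1) ≤ c * B * h * (1 / M) ^ (r + 1) := by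
    refine key.trans ?_
    calc _ ≤ (l ^ a / Real.Gamma a * (2 ^ |a - 1| * (k : ℝ) ^ (a - 1)) * Real.exp (-(l * k))) *
          (1 / M) ^ (r + 1) := by gcongr
      _ = _ := by rw [hB, hh]; field_simp
  have h3 : (M : ℝ) ^ (r + 1) ≤ X ^ (r + 1) := by
    have hXr : X ^ (r + 1) = B * n ^ (r + 1) * h := by
      rw [hX, Real.mul_rpow (by positivity) (by positivity),
        Real.mul_rpow (by positivity) (by positivity), ← Real.rpow_mul hB0.le,
        ← Real.rpow_mul hh0.le, one_div_mul_cancel hr1.ne', Real.rpow_one, Real.rpow_one]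
    rw [Real.div_rpow zero_le_one hn0.le, Real.div_rpow zero_le_one hM0.le, Real.one_rpow,
      mul_one_div, mul_one_div, div_le_div_iff₀ (by positivity) (by positivity)] at h2
    rw [hXr]
    refine le_of_mul_le_mul_left (h2.trans_eq ?_) hc
    ring
  exact absurd h3 (not_le.2 (Real.rpow_lt_rpow hX0.le hXM hr1))

lemma card_filter_scaleCB_le {θ : ℝ} (hθ : 0 < θ) {α : Finset ℝ} {u v u' v' : ℝ}
    (hu : θ * u' ≤ u) (hv : v ≤ θ * v') :
    ((scaleCB θ α).filter fun x => x ∈ Ico u v).card ≤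
      (α.filter fun x => x ∈ Ico u' v').card := by
  refine (Finset.card_le_card ?_).trans
    (Finset.card_image_le (s := α.filter fun x => x ∈ Ico u' v') (f := fun x => θ * x))
  intro x hx
  simp only [scaleCB, Finset.mem_filter, Finset.mem_image, mem_Ico] at hx ⊢
  obtain ⟨⟨z, hz, rfl⟩, h1, h2⟩ := hx
  exact ⟨z, ⟨hz, le_of_mul_le_mul_left (hu.trans h1) hθ,
    lt_of_mul_lt_mul_left (h2.trans_le hv) hθ.le⟩, rfl⟩

lemma OptimalSeq1.exists_setLIntegral_ge_gamma {r s a l : ℝ} (hr : 0 < r) (hs : 0 < s)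
    (hs' : s < r + 1) (ha : 0 < a) (hl : 0 < l) {α : ℕ → Finset ℝ}
    (hα : OptimalSeq1 (volume.withDensity fun x => ENNReal.ofReal (gammaDensity a l x)) r α)
    {θ : ℝ} (hθ0 : 0 < θ) (hθ : θ ≤ s / (r + 1)) :
    ∃ c : ℝ, 0 < c ∧ ∀ k : ℕ, 1 ≤ k → ∀ᶠ n : ℕ in atTop,
      ENNReal.ofReal (c * (1 / k)) ≤ (n : ℝ≥0∞) ^ s *
        ∫⁻ x in Icc (θ * (k + 1 / 4)) (θ * (k + 3 / 4)),
          ENNReal.ofReal (qdist1 x (scaleCB θ (α n))) ^ s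
          ∂(volume.withDensity fun x => ENNReal.ofReal (gammaDensity a l x)) := by
  have hG := gamma_const_pos ha hl
  obtain ⟨C, hC, H⟩ := hα.exists_card_le_gamma hr ha hl
  have hr1 : 0 < r + 1 := by linarith
  set p := s / (r + 1) with hp
  have hp1 : p < 1 := (div_lt_one (by linarith)).2 hs'
  refine ⟨(θ / (16 * C)) ^ s * (l ^ a / Real.Gamma a * 2 ^ (-|a - 1|) * θ ^ (a - 1) *
    Real.exp (-(l * θ))) * (θ / 4), by positivity, fun k hk => ?_⟩
  have hk1 : (1 : ℝ) ≤ k := by exact_mod_cast hk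
  have hk0 : (0 : ℝ) < k := by linarith
  set h := (k : ℝ) ^ (a - 1) * Real.exp (-(l * k)) with hh
  have hh0 : 0 < h := by positivity
  set w := h ^ (1 / (r + 1)) with hw
  have hw0 : 0 < w := by positivity
  filter_upwards [eventually_ge_atTop (⌈3 / (C * w)⌉₊ + 1)] with n hn
  have hn1 : 1 ≤ n := by omega
  have hn0 : (0 : ℝ) < n := by exact_mod_cast hn1
  have h3 : 3 ≤ C * n * w := by
    have h1 := Nat.le_ceil (3 / (C * w))
    have h2 : ((⌈3 / (C * w)⌉₊ + 1 : ℕ) : ℝ) ≤ n := by exact_mod_cast hn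
    push_cast at h2
    have h3 : 3 / (C * w) ≤ n := by linarith
    rw [div_le_iff₀ (by positivity)] at h3
    linarith
  set ε : ℝ := θ / (16 * C) * (1 / (n * w)) with hε
  have hε0 : 0 < ε := by positivity
  have hεC : ε * (C * n * w) = θ / 16 := by rw [hε]; field_simp
  set N := ((α n).filter fun x => x ∈ Ico (k : ℝ) (k + 1)).card with hN
  have hN1 : (N : ℝ) + 1 ≤ 2 * (C * n * w) := by
    have := H n hn1 k hk
    linarith
  have hεN : ε * (N + 1) ≤ θ / 8 := by nlinarith
  have hε8 : ε ≤ θ / 8 := by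
    have : 0 ≤ ε * N := by positivity
    linarith
  have hcard : (((scaleCB θ (α n)).filter fun x => x ∈ Ico (θ * (k + 1 / 4) - 2 * ε)
      (θ * (k + 3 / 4) + 2 * ε)).card : ℝ) ≤ N := by
    exact_mod_cast card_filter_scaleCB_le hθ0 (by linarith) (by linarith)
  set m := l ^ a / Real.Gamma a * (2 ^ (-|a - 1|) * (θ * k) ^ (a - 1)) *
    Real.exp (-(l * (θ * (k + 1)))) with hm
  have hm0 : 0 < m := by positivity
  have key := setLIntegral_qdist1_ge (f := gammaDensity a l) hs
    ((hα n hn1).1.image fun z => θ * z) hε0 hm0.le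
    (u := θ * (k + 1 / 4)) (v := θ * (k + 3 / 4)) (by
      have : 2 * ε * (((scaleCB θ (α n)).filter fun x => x ∈ Ico (θ * (k + 1 / 4) - 2 * ε)
        (θ * (k + 3 / 4) + 2 * ε)).card : ℝ) ≤ 2 * ε * N := by gcongr
      refine this.trans ?_
      linarith) (fun x hx => by
      have hx1 : θ * k ≤ x := by linarith [hx.1]
      have hx2 : x ≤ θ * (k + 1) := by linarith [hx.2]
      refine le_trans ?_ (gammaDensity_ge ha hl (by positivity) hx1 (by nlinarith))
      rw [hm]
      gcongr)
  refine le_trans ?_ (mul_le_mul_right key _)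
  rw [← ENNReal.ofReal_natCast, ENNReal.ofReal_rpow_of_pos hn0,
    ← ENNReal.ofReal_mul (by positivity)]
  apply ENNReal.ofReal_le_ofReal
  have hεs : (n : ℝ) ^ s * ε ^ s =
      (θ / (16 * C)) ^ s * ((k : ℝ) ^ (-((a - 1) * p)) * Real.exp (l * p * k)) := by
    have h1 : n * ε = θ / (16 * C) * w⁻¹ := by rw [hε]; field_simp
    rw [← Real.mul_rpow hn0.le hε0.le, h1, Real.mul_rpow (by positivity) (by positivity)]
    congr 1
    rw [Real.inv_rpow hw0.le, hw, ← Real.rpow_mul hh0.le, ← Real.rpow_neg hh0.le, hh,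
      Real.mul_rpow (by positivity) (by positivity), ← Real.rpow_mul hk0.le, ← Real.exp_mul]
    have h2 : 1 / (r + 1) * s = p := by rw [hp]; ring
    rw [h2]
    congr 2 <;> ring
  have hkk : 1 / (k : ℝ) ≤ (k : ℝ) ^ (-((a - 1) * p)) * Real.exp (l * p * k) *
      ((k : ℝ) ^ (a - 1) * Real.exp (-(l * (θ * k)))) := by
    calc 1 / (k : ℝ) = (k : ℝ) ^ (-1 : ℝ) * 1 := by rw [Real.rpow_neg_one, one_div, mul_one]
      _ ≤ (k : ℝ) ^ ((a - 1) * (1 - p)) * Real.exp (l * (p - θ) * k) := by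
        gcongr
        · have : 0 < p := by positivity
          nlinarith
        · have : 0 ≤ p - θ := by linarith
          exact Real.one_le_exp (by positivity)
      _ = _ := by
        have e1 : (a - 1) * (1 - p) = -((a - 1) * p) + (a - 1) := by ring
        have e2 : l * (p - θ) * k = l * p * k + -(l * (θ * k)) := by ring
        rw [e1, e2, Real.rpow_add hk0, Real.exp_add]
        ring
  have e3 : Real.exp (-(l * (θ * (k + 1)))) = Real.exp (-(l * (θ * k))) * Real.exp (-(l * θ)) := by
    rw [← Real.exp_add]; congr 1; ring
  calc _ ≤ (θ / (16 * C)) ^ s * (l ^ a / Real.Gamma a * 2 ^ (-|a - 1|) * θ ^ (a - 1) *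
        Real.exp (-(l * θ))) * (θ / 4) * ((k : ℝ) ^ (-((a - 1) * p)) * Real.exp (l * p * k) *
          ((k : ℝ) ^ (a - 1) * Real.exp (-(l * (θ * k))))) := by gcongr
    _ = ((n : ℝ) ^ s * ε ^ s) * (m * ((θ * (k + 3 / 4) - θ * (k + 1 / 4)) / 2)) := by
        rw [hεs, hm, e3, Real.mul_rpow hθ0.le hk0.le]; ring
    _ = _ := by ring

lemma OptimalSeq1.lt_of_rateOptimal1_scaleCB_gamma {r s a l : ℝ} (hr : 0 < r) (hs : 0 < s)
    (hs' : s < r + 1) (ha : 0 < a) (hl : 0 < l) {α : ℕ → Finset ℝ}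
    (hα : OptimalSeq1 (volume.withDensity fun x => ENNReal.ofReal (gammaDensity a l x)) r α)
    {θ : ℝ} (hθ0 : 0 < θ)
    (h : RateOptimal1 (volume.withDensity fun x => ENNReal.ofReal (gammaDensity a l x)) s
      (fun n => scaleCB θ (α n))) : s / (r + 1) < θ := by
  by_contra! hθ
  obtain ⟨c, hc, H⟩ := hα.exists_setLIntegral_ge_gamma hr hs hs' ha hl hθ0 hθ
  set L := limsup (fun n : ℕ => (n : ℝ≥0∞) ^ s * qerr1
    (volume.withDensity fun x => ENNReal.ofReal (gammaDensity a l x)) s (scaleCB θ (α n))) atTop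
    with hL
  have hLtop : L ≠ ⊤ := h.ne
  have hsum : ∀ K : ℕ, ENNReal.ofReal (c * ∑ k ∈ Finset.range K, 1 / ((k : ℝ) + 1)) ≤ L := by
    intro K
    refine le_limsup_of_le (by isBoundedDefault) fun b hb => ?_
    have hall : ∀ᶠ n : ℕ in atTop, ∀ k ∈ Finset.range K, ENNReal.ofReal (c * (1 / (k + 1 : ℕ))) ≤
        (n : ℝ≥0∞) ^ s * ∫⁻ x in Icc (θ * ((k + 1 : ℕ) + 1 / 4)) (θ * ((k + 1 : ℕ) + 3 / 4)),
          ENNReal.ofReal (qdist1 x (scaleCB θ (α n))) ^ s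
          ∂(volume.withDensity fun x => ENNReal.ofReal (gammaDensity a l x)) :=
      (Filter.eventually_all_finset _).2 fun k _ => H (k + 1) (by omega)
    obtain ⟨n, hn, hnb⟩ := (hall.and hb).exists
    refine le_trans ?_ hnb
    rw [Finset.mul_sum, ENNReal.ofReal_sum_of_nonneg fun k _ => by positivity]
    calc _ ≤ ∑ k ∈ Finset.range K, (n : ℝ≥0∞) ^ s *
          ∫⁻ x in Icc (θ * ((k + 1 : ℕ) + 1 / 4)) (θ * ((k + 1 : ℕ) + 3 / 4)),
          ENNReal.ofReal (qdist1 x (scaleCB θ (α n))) ^ s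
          ∂(volume.withDensity fun x => ENNReal.ofReal (gammaDensity a l x)) := by
          refine Finset.sum_le_sum fun k hk => ?_
          have := hn k hk
          push_cast at this ⊢
          exact this
      _ ≤ _ := by
        rw [← Finset.mul_sum, ← lintegral_biUnion_finset _ fun k _ => measurableSet_Icc]
        · exact mul_le_mul_right (setLIntegral_le_lintegral _ _) _
        · intro i _ j _ hij
          have aux : ∀ i j : ℕ, i < j →
              Disjoint (Icc (θ * ((i + 1 : ℕ) + 1 / 4)) (θ * ((i + 1 : ℕ) + 3 / 4)))
                (Icc (θ * ((j + 1 : ℕ) + 1 / 4)) (θ * ((j + 1 : ℕ) + 3 / 4))) := by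
            intro i j hij
            refine Set.disjoint_left.2 fun x hx hx' => ?_
            have h1 : (i : ℝ) + 1 ≤ j := by exact_mod_cast hij
            have h2 := hx'.1.trans hx.2
            push_cast at h2
            have h3 := le_of_mul_le_mul_left h2 hθ0
            linarith
          rcases lt_or_gt_of_ne hij with hlt | hlt
          · exact aux i j hlt
          · exact (aux j i hlt).symm
  have htend := Real.tendsto_sum_range_one_div_nat_succ_atTop
  obtain ⟨K, hK⟩ := (htend.eventually_gt_atTop (L.toReal / c)).exists
  have h1 := (ENNReal.ofReal_le_iff_le_toReal hLtop).1 (hsum K)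
  rw [div_lt_iff₀ hc] at hK
  linarith

lemma gammaF_eq {a l r s θ : ℝ} (hr : 0 < r) (hs : 0 < s) (hs' : s < r + 1) (ha : 0 < a)
    (hl : 0 < l) (hθ : s / (r + 1) < θ) :
    gammaF a l r s θ = ENNReal.ofReal ((l ^ a / Real.Gamma a) *
      (l ^ a / Real.Gamma a) ^ (-(s / (r + 1))) *
      ((1 / l) ^ (a - (a - 1) * (s / (r + 1))) * Real.Gamma (a - (a - 1) * (s / (r + 1)))) *
      (θ ^ (s + a) * (1 / (θ - s / (r + 1))) ^ (a - (a - 1) * (s / (r + 1))))) := by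
  have hG := gamma_const_pos ha hl
  set G := l ^ a / Real.Gamma a with hGdef
  set p := s / (r + 1) with hp
  have hp0 : 0 < p := by positivity
  have hp1 : p < 1 := (div_lt_one (by linarith)).2 hs'
  have hθ0 : 0 < θ := hp0.trans hθ
  have hθp : 0 < θ - p := sub_pos.2 hθ
  set b := a - (a - 1) * p with hb
  have hb0 : 0 < b := by rw [hb]; nlinarith
  have hΓ := Real.Gamma_pos_of_pos hb0
  have hint : ∫⁻ x in Ioi (0 : ℝ), ENNReal.ofReal (gammaDensity a l (θ * x)) *
      ENNReal.ofReal (gammaDensity a l x) ^ (-p) =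
      ∫⁻ x in Ioi (0 : ℝ), ENNReal.ofReal (G * G ^ (-p) * θ ^ (a - 1)) *
        ENNReal.ofReal (x ^ (b - 1) * Real.exp (-(l * (θ - p) * x))) := by
    refine setLIntegral_congr_fun measurableSet_Ioi fun x hx => ?_
    have hx0 : (0 : ℝ) < x := hx
    rw [gammaDensity_of_pos a l (mul_pos hθ0 hx0), gammaDensity_of_pos a l hx0, ← hGdef,
      ENNReal.ofReal_rpow_of_pos (by positivity), ← ENNReal.ofReal_mul (by positivity),
      ← ENNReal.ofReal_mul (by positivity)]
    congr 1
    have e1 : b - 1 = (a - 1) + (a - 1) * (-p) := by rw [hb]; ring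
    have e2 : -(l * (θ - p) * x) = -(l * (θ * x)) + -(l * x) * -p := by ring
    have hxa : 0 ≤ x ^ (a - 1) := by positivity
    rw [e1, e2, Real.rpow_add hx0, Real.exp_add, Real.mul_rpow hθ0.le hx0.le,
      Real.mul_rpow (mul_nonneg hG.le hxa) (Real.exp_pos _).le, Real.mul_rpow hG.le hxa,
      ← Real.rpow_mul hx0.le, ← Real.exp_mul]
    ring
  rw [gammaF, hint, lintegral_const_mul' _ _ ENNReal.ofReal_ne_top,
    lintegral_rpow_mul_exp hb0 (mul_pos hl hθp), ENNReal.ofReal_rpow_of_pos hθ0,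
    ← ENNReal.ofReal_mul (by positivity), ← ENNReal.ofReal_mul (by positivity)]
  congr 1
  have e3 : s + a = (s + 1) + (a - 1) := by ring
  have e4 : 1 / (l * (θ - p)) = 1 / l * (1 / (θ - p)) := by field_simp
  rw [e3, Real.rpow_add hθ0 (s + 1) (a - 1), e4, Real.mul_rpow (by positivity) (by positivity)]
  ring

/-- `θ ↦ θ ^ u * (θ - p) ^ (-b)` has a strict global minimum on `(p, ∞)` at `p * u / (u - b)`. -/
lemma rpow_mul_one_div_sub_rpow_lt {p u b θ θ₀ : ℝ} (hp : 0 < p) (hb : 0 < b) (hbu : b < u)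
    (hθ₀ : θ₀ * (u - b) = p * u) (hθ : p < θ) (hne : θ ≠ θ₀) :
    θ₀ ^ u * (1 / (θ₀ - p)) ^ b < θ ^ u * (1 / (θ - p)) ^ b := by
  have hub : 0 < u - b := sub_pos.2 hbu
  have hu : 0 < u := hb.trans hbu
  have hθ₀pos : 0 < θ₀ := pos_of_mul_pos_left (hθ₀ ▸ mul_pos hp hu) hub.le
  have hd₀ : (θ₀ - p) * (u - b) = p * b := by linear_combination hθ₀
  have hd₀pos : 0 < θ₀ - p := pos_of_mul_pos_left (hd₀ ▸ mul_pos hp hb) hub.le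
  have hθpos : 0 < θ := hp.trans hθ
  have hdpos : 0 < θ - p := sub_pos.2 hθ
  have h1 := Real.log_le_sub_one_of_pos (x := (θ - p) / (θ₀ - p) / (θ / θ₀)) (by positivity)
  have h2 := Real.log_lt_sub_one_of_pos (x := θ₀ / θ) (by positivity) (by
    rw [Ne, div_eq_one_iff_eq hθpos.ne']; exact hne.symm)
  rw [Real.log_div (by positivity) (by positivity), Real.log_div hdpos.ne' hd₀pos.ne',
    Real.log_div hθpos.ne' hθ₀pos.ne'] at h1
  rw [Real.log_div hθ₀pos.ne' hθpos.ne'] at h2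
  have h3 : b * ((θ - p) / (θ₀ - p) / (θ / θ₀) - 1) + (u - b) * (θ₀ / θ - 1) = 0 := by
    have e1 : θ₀ - p = p * b / (u - b) := by rw [eq_div_iff hub.ne', hd₀]
    have e2 : θ₀ = p * u / (u - b) := by rw [eq_div_iff hub.ne', hθ₀]
    rw [e1, e2]
    field_simp
    ring
  have h4 := mul_le_mul_of_nonneg_left h1 hb.le
  have h5 := mul_lt_mul_of_pos_left h2 hub
  rw [← Real.log_lt_log_iff (by positivity) (by positivity),
    Real.log_mul (by positivity) (by positivity), Real.log_mul (by positivity) (by positivity),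
    Real.log_rpow hθ₀pos, Real.log_rpow hθpos, Real.log_rpow (by positivity),
    Real.log_rpow (by positivity), one_div, one_div, Real.log_inv, Real.log_inv]
  linarith

lemma gammaF_lt {a l r s θ : ℝ} (hr : 0 < r) (hs : 0 < s) (hs' : s < r + 1) (ha : 0 < a)
    (hl : 0 < l) (hθ : s / (r + 1) < θ) (hne : θ ≠ (s + a) / (r + a)) :
    gammaF a l r s ((s + a) / (r + a)) < gammaF a l r s θ := by
  have hG := gamma_const_pos ha hl
  have hr1 : 0 < r + 1 := by linarith
  have hra : 0 < r + a := by linarith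
  have hθ₀ : s / (r + 1) < (s + a) / (r + a) := by
    rw [div_lt_div_iff₀ hr1 hra]
    nlinarith
  rw [gammaF_eq hr hs hs' ha hl hθ, gammaF_eq hr hs hs' ha hl hθ₀]
  have hub : s + a - (a - (a - 1) * (s / (r + 1))) = s / (r + 1) * (r + a) := by
    field_simp
    ring
  set p := s / (r + 1) with hp
  have hp0 : 0 < p := by positivity
  have hp1 : p < 1 := (div_lt_one (by linarith)).2 hs'
  set b := a - (a - 1) * p with hb
  have hb0 : 0 < b := by rw [hb]; nlinarith
  have hΓ := Real.Gamma_pos_of_pos hb0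
  have key := rpow_mul_one_div_sub_rpow_lt hp0 hb0
    (sub_pos.1 (hub ▸ mul_pos hp0 hra) : b < s + a)
    (θ₀ := (s + a) / (r + a)) (by rw [hub]; field_simp) hθ hne
  have hθ0 : 0 < θ := hp0.trans hθ
  have hθp : 0 < θ - p := sub_pos.2 hθ
  refine (ENNReal.ofReal_lt_ofReal_iff (by positivity)).2 (mul_lt_mul_of_pos_left key ?_)
  positivity

/-- **Proposition 5.6 (a), Gamma distribution, `s ∈ (r, r+1)`.**
Let `r > 0`, `s ∈ (r, r+1)`, `a, λ > 0`, `X ~ Γ(a,λ)`, `(α_n)` `L^r(P)`-optimal.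
Then (i) `(θ·α_n)` is `L^s(P)`-rate-optimal iff `θ ∈ (s/(r+1), ∞)`;
(ii) `θ* = (s+a)/(r+a)` is the unique minimizer of
`θ ↦ θ^{s+1} ∫_0^∞ f(θx) f(x)^{-s/(r+1)} dx` on `(s/(r+1), ∞)`. -/
theorem stmt_18 (r s : ℝ) (hr : 0 < r) (hs : r < s) (hs' : s < r + 1)
    (a l : ℝ) (ha : 0 < a) (hl : 0 < l)
    (P : Measure ℝ)
    (hP : P = volume.withDensity fun x => ENNReal.ofReal (gammaDensity a l x))
    (α : ℕ → Finset ℝ) (hα : OptimalSeq1 P r α) :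
    (∀ θ : ℝ, 0 < θ →
      (RateOptimal1 P s (fun n => scaleCB θ (α n)) ↔ s / (r + 1) < θ)) ∧
    (∀ θ : ℝ, s / (r + 1) < θ →
      gammaF a l r s ((s + a) / (r + a)) ≤ gammaF a l r s θ ∧
      (gammaF a l r s θ = gammaF a l r s ((s + a) / (r + a)) →
        θ = (s + a) / (r + a))) := by
  subst hP
  have hs0 : 0 < s := hr.trans hs
  refine ⟨fun θ hθ => ⟨fun h => hα.lt_of_rateOptimal1_scaleCB_gamma hr hs0 hs' ha hl hθ h,
    fun h => hα.rateOptimal1_scaleCB_gamma hr hs0 hs' ha hl h⟩, fun θ hθ => ?_⟩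
  by_cases hne : θ = (s + a) / (r + a)
  · exact ⟨by rw [hne], fun _ => hne⟩
  · have hlt := gammaF_lt hr hs0 hs' ha hl hθ hne
    exact ⟨hlt.le, fun h => absurd h hlt.ne'⟩
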